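/- Suppose A, B, C, D ∈ End(ℂⁿ⊗ℂⁿ) satisfy the Yang–Baxter consistency relations and the unitarity conditions, and let T̃ ∈ End(V)⊗R satisfy the quadratic exchange relation A₁₂T̃₁B₁₂T̃₂ = T̃₂C₁₂T̃₁D₁₂. Define, for each ordered label set M = ⟨1,…,m⟩, T̃_M := ∏→_{i∈M} ( (∏→_{j∈M, j>i} A_{ij}) · T̃_i · (∏←_{j∈M, j>i} B_{ij}) ). Then for all disjoint ordered label sets M, N′ the DKM-type fused exchange relation holds: A_{M̄N′} T̃_M B_{MN̄′} T̃_{N′} = T̃_{N′} C_{M̄N′} T̃_M D_{MN̄′}. Moreover T̃_M = L_M T_M, where T_M := ∏→_{i∈M}( T̃_i ∏→_{j∈M, j>i} B_{ij} ) and L_M := ∏ over 1 ≤ i < j ≤ m (lexicographic order) of A_{ij}. -/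

import Mathlib

open Matrix

namespace QT

variable {n : ℕ} {ι : Type*} [Fintype ι] [DecidableEq ι] {α : Type*}
variable {R : Type*} [Ring R] [Algebra ℂ R]

/-- Operators on `V^{⊗ι}`, `V = ℂⁿ`, with entries in `α`. -/
abbrev Tens (ι : Type*) (n : ℕ) (α : Type*) := Matrix (ι → Fin n) (ι → Fin n) α

/-- Two-site matrices, i.e. elements of `End(V ⊗ V)` with entries in `α`. -/
abbrev M2 (n : ℕ) (α : Type*) := Matrix (Fin n × Fin n) (Fin n × Fin n) α

/-- `X_{ij}` : embedding of a two-site matrix at the (distinct) sites `i, j`,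
acting as the identity elsewhere. -/
noncomputable def emb2 [MulZeroOneClass α] (X : M2 n α) (i j : ι) : Tens ι n α :=
  Matrix.of fun f g =>
    if ∀ k, k ≠ i → k ≠ j → f k = g k then X (f i, f j) (g i, g j) else 0

/-- `T_i` : embedding of a one-site matrix at site `i`. -/
noncomputable def emb1 [Zero α] (T : Matrix (Fin n) (Fin n) α) (i : ι) : Tens ι n α :=
  Matrix.of fun f g => if ∀ k, k ≠ i → f k = g k then T (f i) (g i) else 0

/-- Fused matrix `X_{MN} = ∏→_{i∈M} ∏→_{j∈N} X_{ij}` (a bar, i.e. reversal of one of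
the ordered label sets, is obtained by passing `M.reverse` or `N.reverse`). -/
noncomputable def fuse [Semiring α] (X : M2 n α) (M N : List ι) : Tens ι n α :=
  (M.map fun i => (N.map fun j => emb2 X i j).prod).prod

/-- Partial transposition `t_S` in the factors labelled by `S`. -/
noncomputable def ptrans (S : Finset ι) (X : Tens ι n α) : Tens ι n α :=
  Matrix.of fun f g =>
    X (fun k => if k ∈ S then g k else f k) (fun k => if k ∈ S then f k else g k)

/-- Partial transposition `t₁` on a two-site matrix. -/
noncomputable def t1 (X : M2 n α) : M2 n α :=
  Matrix.of fun p q => X (q.1, p.2) (p.1, q.2)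

/-- Partial transposition `t₂` on a two-site matrix. -/
noncomputable def t2 (X : M2 n α) : M2 n α :=
  Matrix.of fun p q => X (p.1, q.2) (q.1, p.2)

/-- `X₂₁ = P X₁₂ P` : permutation of the two factors of a two-site matrix. -/
noncomputable def perm2 (X : M2 n α) : M2 n α :=
  Matrix.of fun p q => X (p.2, p.1) (q.2, q.1)

/-- The permutation (flip) matrix `P` on `V ⊗ V`. -/
noncomputable def PM (n : ℕ) (α : Type*) [Zero α] [One α] : M2 n α :=
  Matrix.of fun p q => if p.1 = q.2 ∧ p.2 = q.1 then 1 else 0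

/-- Index type for `V^{⊗M}`. -/
abbrev idx (n : ℕ) {ι : Type*} [DecidableEq ι] (M : List ι) :=
  {x // x ∈ M.toFinset} → Fin n

/-- Embedding `End(V^{⊗M}) ⊗ R → End(V^{⊗ι}) ⊗ R`, acting as the identity off `M`. -/
noncomputable def embS [Zero α] (M : List ι) (X : Matrix (idx n M) (idx n M) α) :
    Tens ι n α :=
  Matrix.of fun f g =>
    if ∀ k, k ∉ M.toFinset → f k = g k then
      X (fun i => f i.1) (fun i => g i.1) else 0

/-- A pair of disjoint ordered label sets. -/
def OkPair (M N : List ι) : Prop := M.Nodup ∧ N.Nodup ∧ M.Disjoint N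

/-- Fused solution `T_M = ∏→_{i∈M} ( T_i ∏→_{j∈M, j>i} B_{ij} )` of the quadratic
exchange algebra (also used for the dual fusion, with `B` replaced by the
appropriate dual structure matrix). -/
noncomputable def fuseT (B : M2 n ℂ) (T : Matrix (Fin n) (Fin n) R) :
    List ι → Tens ι n R
  | [] => 1
  | i :: M => emb1 T i *
      ((M.map fun j => (emb2 B i j).map (algebraMap ℂ R)).prod) * fuseT B T M

/-- The chain `X̌_{i₁i₂} X̌_{i₂i₃} ⋯ X̌_{i_{m-1}i_m}` along the ordered label set,
where `X̌_{ij} = P_{ij} X_{ij}`. -/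
noncomputable def chainCheck (X : M2 n ℂ) : List ι → Tens ι n ℂ
  | [] => 1
  | [_] => 1
  | i :: j :: M => emb2 (PM n ℂ * X) i j * chainCheck X (j :: M)

/-- The lexicographically ordered product `L_M = ∏_{i<j ∈ M} A_{ij}`. -/
noncomputable def lexA (A : M2 n ℂ) : List ι → Tens ι n ℂ
  | [] => 1
  | i :: M => (M.map fun j => emb2 A i j).prod * lexA A M

/-- DKM-type fused solution
`T̃_M = ∏→_{i∈M} ( (∏→_{j>i} A_{ij}) T_i (∏←_{j>i} B_{ij}) )`. -/
noncomputable def fuseT2 (A B : M2 n ℂ) (T : Matrix (Fin n) (Fin n) R) :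
    List ι → Tens ι n R
  | [] => 1
  | i :: M => ((M.map fun j => emb2 A i j).prod).map (algebraMap ℂ R) * emb1 T i *
      ((M.reverse.map fun j => emb2 B i j).prod).map (algebraMap ℂ R) * fuseT2 A B T M

/-! ### Dynamical setting -/

/-- the space of dynamical parameters `λ ∈ ℂⁿ`. -/
abbrev Lam (n : ℕ) := Fin n → ℂ

/-- standard basis vector `e_a` of `ℂⁿ`. -/
noncomputable def ee {n : ℕ} (a : Fin n) : Lam n := Pi.single a 1

/-- `Σ_{k∈S} e_{f k}` : the dynamical shift read off the indices at the factors in `S`. -/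
noncomputable def shL (S : Finset ι) (f : ι → Fin n) : Lam n := ∑ k ∈ S, ee (f k)

/-- The dynamical shift `X(λ + h_S)` of a matrix-valued function of `λ` (which is
assumed to act as the identity on the factors labelled by `S`). -/
noncomputable def dsh (S : Finset ι) (X : Lam n → Tens ι n α) : Lam n → Tens ι n α :=
  fun lam => Matrix.of fun f g => X (lam + shL S f) f g

/-- Dynamical structure matrices `ℂⁿ → End(V⊗V)`. -/
abbrev DSM (n : ℕ) := Lam n → M2 n ℂ

/-- Fused `A_{MN̄′}` (no dynamical shifts occur in the recursion for `A`). -/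
noncomputable def fuseAd (A : DSM n) (M N : List ι) : Lam n → Tens ι n ℂ :=
  fun lam => fuse (A lam) M N.reverse

/-- Fused `B_{MN′} = B_{1N′} ⋅ B_{M₀N′}(λ+h₁)`. -/
noncomputable def fuseBd (B : DSM n) : List ι → List ι → Lam n → Tens ι n ℂ
  | [], _ => fun _ => 1
  | i :: M, N => fun lam =>
      ((N.map fun j => emb2 (B lam) i j).prod) * dsh {i} (fuseBd B M N) lam

/-- Fused `C_{MN′} = C_{M1′} ⋅ C_{MN′₀}(λ+h_{1′})`. -/
noncomputable def fuseCd (C : DSM n) : List ι → List ι → Lam n → Tens ι n ℂ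
  | _, [] => fun _ => 1
  | M, j :: N => fun lam =>
      ((M.map fun i => emb2 (C lam) i j).prod) * dsh {j} (fuseCd C M N) lam

/-- Fused `D_{iN̄′} = D_{in′}(λ+h_{(1′,n′-1)}) ⋅ D_{i,(N̄′)₀}` (`Nr` is the reversed `N′`). -/
noncomputable def fuseD1 (D : DSM n) (i : ι) : List ι → Lam n → Tens ι n ℂ
  | [] => fun _ => 1
  | j :: Nr => fun lam =>
      dsh Nr.toFinset (fun mu => emb2 (D mu) i j) lam * fuseD1 D i Nr lam

/-- Fused `D_{MN̄′} = D_{1N̄′} ⋅ D_{M₀N̄′}(λ+h₁)`. -/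
noncomputable def fuseDd (D : DSM n) : List ι → List ι → Lam n → Tens ι n ℂ
  | [], _ => fun _ => 1
  | i :: M, N => fun lam => fuseD1 D i N.reverse lam * dsh {i} (fuseDd D M N) lam

/-- zero-weight condition on the first factor: `[B₁₂, h⊗1] = 0` for all diagonal `h`. -/
def WB (B : DSM n) : Prop := ∀ lam (d : Fin n → ℂ),
  B lam * Matrix.diagonal (fun p => d p.1) = Matrix.diagonal (fun p => d p.1) * B lam

/-- zero-weight condition on the second factor: `[C₁₂, 1⊗h] = 0` for all diagonal `h`. -/
def WC (C : DSM n) : Prop := ∀ lam (d : Fin n → ℂ),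
  C lam * Matrix.diagonal (fun p => d p.2) = Matrix.diagonal (fun p => d p.2) * C lam

/-- total zero-weight condition: `[D₁₂, h⊗1 + 1⊗h] = 0` for all diagonal `h`. -/
def WD (D : DSM n) : Prop := ∀ lam (d : Fin n → ℂ),
  D lam * Matrix.diagonal (fun p => d p.1 + d p.2)
    = Matrix.diagonal (fun p => d p.1 + d p.2) * D lam

/-- The four coupled semi-dynamical Yang–Baxter equations, on `V⊗V⊗V`. -/
def SDYB (A B C D : DSM n) : Prop :=
  (∀ lam, emb2 (ι := Fin 3) (A lam) 0 1 * emb2 (A lam) 0 2 * emb2 (A lam) 1 2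
      = emb2 (A lam) 1 2 * emb2 (A lam) 0 2 * emb2 (A lam) 0 1) ∧
  (∀ lam, dsh {2} (fun mu => emb2 (ι := Fin 3) (D mu) 0 1) lam * emb2 (D lam) 0 2 *
        dsh {0} (fun mu => emb2 (D mu) 1 2) lam
      = emb2 (D lam) 1 2 * dsh {1} (fun mu => emb2 (D mu) 0 2) lam * emb2 (D lam) 0 1) ∧
  (∀ lam, emb2 (ι := Fin 3) (D lam) 0 1 * emb2 (B lam) 0 2 *
        dsh {0} (fun mu => emb2 (B mu) 1 2) lam
      = emb2 (B lam) 1 2 * dsh {1} (fun mu => emb2 (B mu) 0 2) lam * emb2 (D lam) 0 1) ∧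
  (∀ lam, emb2 (ι := Fin 3) (A lam) 0 1 * emb2 (C lam) 0 2 * emb2 (C lam) 1 2
      = emb2 (C lam) 1 2 * emb2 (C lam) 0 2 * dsh {2} (fun mu => emb2 (A mu) 0 1) lam)

/-- Fused semi-dynamical solution
`T_M(λ) = ∏→_{i∈M} ( T_i(λ + h_{{k∈M : k<i}}) ∏→_{j∈M, j>i} B_{ij}(λ) )`. -/
noncomputable def fuseTd (B : DSM n) (T : Lam n → Matrix (Fin n) (Fin n) R)
    (M : List ι) : Lam n → Tens ι n R := fun lam =>
  (M.map fun i =>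
    dsh ((M.takeWhile (fun k => decide (k ≠ i))).toFinset)
        (fun mu => emb1 (T mu) i) lam *
    ((((M.dropWhile (fun k => decide (k ≠ i))).tail).map fun j =>
        emb2 (B lam) i j).prod).map (algebraMap ℂ R)).prod


section Words

variable {S : Type*} [Monoid S] {ι : Type*}

/-- A relation `z x_j y_j = y_j x_j z` propagates to products over a list. -/
theorem mul_prod_mul_prod {x y : ι → S} {z : S} {N : List ι} (hN : N.Nodup)
    (h : ∀ j ∈ N, z * x j * y j = y j * x j * z)
    (hc : ∀ j ∈ N, ∀ k ∈ N, j ≠ k → Commute (x j) (y k)) :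
    z * (N.map x).prod * (N.map y).prod = (N.map y).prod * (N.map x).prod * z := by
  induction N with
  | nil => simp
  | cons j N ih =>
    obtain ⟨hj, hN⟩ := List.nodup_cons.1 hN
    have ih := ih hN (fun k hk => h k (by simp [hk]))
      (fun k hk l hl => hc k (by simp [hk]) l (by simp [hl]))
    have hXy : Commute (N.map x).prod (y j) := Commute.list_prod_left _ _ fun s hs => by
      obtain ⟨k, hk, rfl⟩ := List.mem_map.1 hs
      exact hc k (by simp [hk]) j (by simp) (fun e => hj (e ▸ hk))
    have hxY : Commute (x j) (N.map y).prod := Commute.list_prod_right _ _ fun s hs => by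
      obtain ⟨k, hk, rfl⟩ := List.mem_map.1 hs
      exact hc j (by simp) k (by simp [hk]) (fun e => hj (e ▸ hk))
    simp only [List.map_cons, List.prod_cons]
    generalize (N.map x).prod = X at *
    generalize (N.map y).prod = Y at *
    calc z * (x j * X) * (y j * Y) = z * x j * (X * y j) * Y := by simp only [mul_assoc]
      _ = (z * x j * y j) * X * Y := by rw [hXy.eq]; simp only [mul_assoc]
      _ = y j * x j * (z * X * Y) := by rw [h j (by simp)]; simp only [mul_assoc]
      _ = y j * (x j * Y) * X * z := by rw [ih]; simp only [mul_assoc]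
      _ = y j * Y * (x j * X) * z := by rw [hxY.eq]; simp only [mul_assoc]

/-- A relation `z_j x y_j = y_j x z_j` propagates to oppositely ordered products over a list. -/
theorem prod_mul_mul_prod_reverse {z y : ι → S} {x : S} {N : List ι} (hN : N.Nodup)
    (h : ∀ j ∈ N, z j * x * y j = y j * x * z j)
    (hc : ∀ j ∈ N, ∀ k ∈ N, j ≠ k → Commute (z j) (y k)) :
    (N.map z).prod * x * (N.reverse.map y).prod
      = (N.reverse.map y).prod * x * (N.map z).prod := by
  induction N with
  | nil => simp
  | cons j N ih =>
    obtain ⟨hj, hN⟩ := List.nodup_cons.1 hN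
    have ih := ih hN (fun k hk => h k (by simp [hk]))
      (fun k hk l hl => hc k (by simp [hk]) l (by simp [hl]))
    have hZy : Commute (N.map z).prod (y j) := Commute.list_prod_left _ _ fun s hs => by
      obtain ⟨k, hk, rfl⟩ := List.mem_map.1 hs
      exact hc k (by simp [hk]) j (by simp) (fun e => hj (e ▸ hk))
    have hzY : Commute (z j) (N.reverse.map y).prod := Commute.list_prod_right _ _ fun s hs => by
      obtain ⟨k, hk, rfl⟩ := List.mem_map.1 hs
      have hk := List.mem_reverse.1 hk
      exact hc j (by simp) k (by simp [hk]) (fun e => hj (e ▸ hk))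
    simp only [List.map_cons, List.prod_cons, List.reverse_cons, List.map_append, List.prod_append,
      List.map_nil, List.prod_nil, mul_one]
    generalize (N.map z).prod = Z at *
    generalize (N.reverse.map y).prod = Y at *
    calc z j * Z * x * (Y * y j) = z j * (Z * x * Y) * y j := by simp only [mul_assoc]
      _ = (z j * Y) * x * (Z * y j) := by rw [ih]; simp only [mul_assoc]
      _ = Y * (z j * x * y j) * Z := by rw [hzY.eq, hZy.eq]; simp only [mul_assoc]
      _ = Y * y j * x * (z j * Z) := by rw [h j (by simp)]; simp only [mul_assoc]

end Words

section Exchange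

variable {S : Type*} [Monoid S] {ι K : Type*}

/-- Elements `u X i j`, `t i` of a monoid with the locality, Yang–Baxter and quadratic exchange
relations of the operators `X_{ij}`, `T_i`. -/
structure IsExchange (u : K → ι → ι → S) (t : ι → S) (A B C D : K) : Prop where
  comm : ∀ X Y i j k l, i ≠ k → i ≠ l → j ≠ k → j ≠ l → Commute (u X i j) (u Y k l)
  comm_t : ∀ X i j k, i ≠ j → i ≠ k → Commute (t i) (u X j k)
  flip : ∀ i j, u C i j = u B j i
  yb : ∀ i j k, i ≠ j → i ≠ k → j ≠ k →
    u A i j * u A i k * u A j k = u A j k * u A i k * u A i j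
  ybC : ∀ i j k, i ≠ j → i ≠ k → j ≠ k →
    u A i j * u C i k * u C j k = u C j k * u C i k * u A i j
  ybB : ∀ i j k, i ≠ j → i ≠ k → j ≠ k →
    u D i j * u B i k * u B j k = u B j k * u B i k * u D i j
  exch : ∀ i j, i ≠ j → u A i j * t i * u B i j * t j = t j * u C i j * t i * u D i j

/-- The product `∏→_{j∈N} X_{ij}`. -/
def row (u : K → ι → ι → S) (X : K) (i : ι) (N : List ι) : S := (N.map (u X i)).prod

/-- The product `∏→_{i∈M} ∏→_{j∈N} X_{ij}`. -/
def block (u : K → ι → ι → S) (X : K) (M N : List ι) : S :=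
  (M.map fun i => row u X i N).prod

/-- The DKM-type fused solution in a monoid. -/
def tilde (u : K → ι → ι → S) (t : ι → S) (A B : K) : List ι → S
  | [] => 1
  | i :: M => row u A i M * t i * row u B i M.reverse * tilde u t A B M

/-- The KS-type fused solution in a monoid. -/
def straight (u : K → ι → ι → S) (t : ι → S) (B : K) : List ι → S
  | [] => 1
  | i :: M => t i * row u B i M * straight u t B M

/-- The lexicographically ordered product `∏_{i<j} A_{ij}` in a monoid. -/
def lex (u : K → ι → ι → S) (A : K) : List ι → S
  | [] => 1
  | i :: M => row u A i M * lex u A M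

theorem Commute.row_right {u : K → ι → ι → S} {X : K} {i : ι} {N : List ι} {s : S}
    (h : ∀ j ∈ N, Commute s (u X i j)) : Commute s (row u X i N) :=
  Commute.list_prod_right _ _ fun r hr => by
    obtain ⟨j, hj, rfl⟩ := List.mem_map.1 hr
    exact h j hj

theorem Commute.block_right {u : K → ι → ι → S} {X : K} {M N : List ι} {s : S}
    (h : ∀ i ∈ M, ∀ j ∈ N, Commute s (u X i j)) : Commute s (block u X M N) :=
  Commute.list_prod_right _ _ fun r hr => by
    obtain ⟨i, hi, rfl⟩ := List.mem_map.1 hr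
    exact Commute.row_right (h i hi)

theorem Commute.tilde_right {u : K → ι → ι → S} {t : ι → S} {A B : K} {N : List ι} {s : S}
    (h : ∀ X, ∀ i ∈ N, ∀ j ∈ N, Commute s (u X i j)) (ht : ∀ i ∈ N, Commute s (t i)) :
    Commute s (tilde u t A B N) := by
  induction N with
  | nil => exact Commute.one_right s
  | cons i N ih =>
    refine (((Commute.row_right fun j hj => h A i (by simp) j (by simp [hj])).mul_right
      (ht i (by simp))).mul_right
      (Commute.row_right fun j hj => h B i (by simp) j ?_)).mul_right
      (ih (fun X j hj k hk => h X j (by simp [hj]) k (by simp [hk]))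
        fun j hj => ht j (by simp [hj]))
    simpa using Or.inr hj

theorem Commute.lex_right {u : K → ι → ι → S} {A : K} {M : List ι} {s : S}
    (h : ∀ i ∈ M, ∀ j ∈ M, Commute s (u A i j)) : Commute s (lex u A M) := by
  induction M with
  | nil => exact Commute.one_right s
  | cons i M ih =>
    exact (Commute.row_right fun j hj => h i (by simp) j (by simp [hj])).mul_right
      (ih fun j hj k hk => h j (by simp [hj]) k (by simp [hk]))

theorem row_cons (u : K → ι → ι → S) (X : K) (i j : ι) (N : List ι) :
    row u X i (j :: N) = u X i j * row u X i N := by simp [row]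

theorem row_reverse_cons (u : K → ι → ι → S) (X : K) (i j : ι) (N : List ι) :
    row u X i (j :: N).reverse = row u X i N.reverse * u X i j := by simp [row]

theorem block_cons (u : K → ι → ι → S) (X : K) (i : ι) (M N : List ι) :
    block u X (i :: M) N = row u X i N * block u X M N := by simp [block]

theorem block_reverse_cons (u : K → ι → ι → S) (X : K) (i : ι) (M N : List ι) :
    block u X (i :: M).reverse N = block u X M.reverse N * row u X i N := by simp [block]

namespace IsExchange

variable {u : K → ι → ι → S} {t : ι → S} {A B C D : K}

theorem ybC' (H : IsExchange u t A B C D)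
    (i j k : ι) (hij : i ≠ j) (hik : i ≠ k) (hjk : j ≠ k) :
    u A i j * u B k i * u B k j = u B k j * u B k i * u A i j := by
  simpa only [H.flip] using H.ybC i j k hij hik hjk

/-- `A_{kN} B_{ik} B_{iN̄} = B_{iN̄} B_{ik} A_{kN}`. -/
theorem row_A_B_B (H : IsExchange u t A B C D)
    {i k : ι} {N : List ι} (hik : i ≠ k) (hi : i ∉ N) (hk : k ∉ N)
    (hN : N.Nodup) :
    row u A k N * u B i k * row u B i N.reverse = row u B i N.reverse * u B i k * row u A k N :=
  prod_mul_mul_prod_reverse hN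
    (fun j hj => H.ybC' k j i (by grind) (by grind) (by grind))
    fun j hj l hl hjl => H.comm _ _ _ _ _ _ (by grind) (by grind) (by grind) (by grind)

/-- `A_{ij} A_{iN} A_{jN} = A_{jN} A_{iN} A_{ij}`. -/
theorem row_A_A_A (H : IsExchange u t A B C D)
    {i j : ι} {N : List ι} (hij : i ≠ j) (hi : i ∉ N) (hj : j ∉ N)
    (hN : N.Nodup) : u A i j * row u A i N * row u A j N = row u A j N * row u A i N * u A i j :=
  mul_prod_mul_prod hN
    (fun k hk => H.yb i j k (by grind) (by grind) (by grind))
    fun j hj l hl hjl => H.comm _ _ _ _ _ _ (by grind) (by grind) (by grind) (by grind)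

/-- `A_{ij} C_{iN} C_{jN} = C_{jN} C_{iN} A_{ij}`. -/
theorem row_A_C_C (H : IsExchange u t A B C D)
    {i j : ι} {N : List ι} (hij : i ≠ j) (hi : i ∉ N) (hj : j ∉ N)
    (hN : N.Nodup) : u A i j * row u C i N * row u C j N = row u C j N * row u C i N * u A i j :=
  mul_prod_mul_prod hN
    (fun k hk => H.ybC i j k (by grind) (by grind) (by grind))
    fun j hj l hl hjl => H.comm _ _ _ _ _ _ (by grind) (by grind) (by grind) (by grind)

/-- `D_{ij} B_{iN} B_{jN} = B_{jN} B_{iN} D_{ij}`. -/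
theorem row_D_B_B (H : IsExchange u t A B C D)
    {i j : ι} {N : List ι} (hij : i ≠ j) (hi : i ∉ N) (hj : j ∉ N)
    (hN : N.Nodup) : u D i j * row u B i N * row u B j N = row u B j N * row u B i N * u D i j :=
  mul_prod_mul_prod hN
    (fun k hk => H.ybB i j k (by grind) (by grind) (by grind))
    fun j hj l hl hjl => H.comm _ _ _ _ _ _ (by grind) (by grind) (by grind) (by grind)

/-- `A_{iN} C_{ij} B_{jN̄} = B_{jN̄} C_{ij} A_{iN}`. -/
theorem row_A_C_B (H : IsExchange u t A B C D)
    {i j : ι} {N : List ι} (hij : i ≠ j) (hi : i ∉ N) (hj : j ∉ N)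
    (hN : N.Nodup) :
    row u A i N * u C i j * row u B j N.reverse = row u B j N.reverse * u C i j * row u A i N := by
  rw [H.flip]
  exact H.row_A_B_B hij.symm hj hi hN

/-- `D_{iN̄} B_{ik} C_{kN} = C_{kN} B_{ik} D_{iN̄}`. -/
theorem row_D_B_C (H : IsExchange u t A B C D)
    {i k : ι} {N : List ι} (hik : i ≠ k) (hi : i ∉ N) (hk : k ∉ N)
    (hN : N.Nodup) :
    row u D i N.reverse * u B i k * row u C k N = row u C k N * u B i k * row u D i N.reverse :=
  (prod_mul_mul_prod_reverse hN
    (fun j hj => by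
      rw [H.flip]; exact (H.ybB i j k (by grind) (by grind) (by grind)).symm)
    fun j hj l hl hjl => H.comm _ _ _ _ _ _ (by grind) (by grind) (by grind) (by grind)).symm

/-- `A_{iM} A_{iN} A_{M̄N} = A_{M̄N} A_{iN} A_{iM}`. -/
theorem block_A_A_A (H : IsExchange u t A B C D)
    {i : ι} {M N : List ι} (hi : i ∉ M) (hi' : i ∉ N) (hM : M.Nodup)
    (hN : N.Nodup) (hMN : M.Disjoint N) :
    row u A i M * row u A i N * block u A M.reverse N
      = block u A M.reverse N * row u A i N * row u A i M :=
  prod_mul_mul_prod_reverse hM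
    (fun k hk => H.row_A_A_A (by grind) hi' (hMN hk) hN)
    fun j hj l hl hjl => Commute.row_right fun k hk =>
      H.comm _ _ _ _ _ _ (by grind) (by grind) (by grind) (fun e => hMN hj (e ▸ hk))

/-- `A_{iM} C_{iN} C_{M̄N} = C_{M̄N} C_{iN} A_{iM}`. -/
theorem block_A_C_C (H : IsExchange u t A B C D)
    {i : ι} {M N : List ι} (hi : i ∉ M) (hi' : i ∉ N) (hM : M.Nodup)
    (hN : N.Nodup) (hMN : M.Disjoint N) :
    row u A i M * row u C i N * block u C M.reverse N
      = block u C M.reverse N * row u C i N * row u A i M :=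
  prod_mul_mul_prod_reverse hM
    (fun k hk => H.row_A_C_C (by grind) hi' (hMN hk) hN)
    fun j hj l hl hjl => Commute.row_right fun k hk =>
      H.comm _ _ _ _ _ _ (by grind) (by grind) (by grind) (fun e => hMN hj (e ▸ hk))

/-- `A_{M̄N} B_{iM̄} B_{iN̄} = B_{iN̄} B_{iM̄} A_{M̄N}`. -/
theorem block_A_B_B (H : IsExchange u t A B C D)
    {i : ι} {M N : List ι} (hi : i ∉ M) (hi' : i ∉ N) (hM : M.Nodup)
    (hN : N.Nodup) (hMN : M.Disjoint N) :
    block u A M.reverse N * row u B i M.reverse * row u B i N.reverse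
      = row u B i N.reverse * row u B i M.reverse * block u A M.reverse N :=
  (mul_prod_mul_prod (List.nodup_reverse.2 hM)
    (fun k hk => by
      have hk := List.mem_reverse.1 hk
      exact (H.row_A_B_B (by grind) hi' (hMN hk) hN).symm)
    fun j hj l hl hjl => Commute.row_right fun k hk => by
      have hj := List.mem_reverse.1 hj
      have hl := List.mem_reverse.1 hl
      exact H.comm _ _ _ _ _ _ (by grind) (by grind) (by grind) (fun e => hMN hj (e ▸ hk))).symm

/-- `D_{iN̄} B_{iM̄} C_{M̄N} = C_{M̄N} B_{iM̄} D_{iN̄}`. -/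
theorem block_D_B_C (H : IsExchange u t A B C D)
    {i : ι} {M N : List ι} (hi : i ∉ M) (hi' : i ∉ N) (hM : M.Nodup)
    (hN : N.Nodup) (hMN : M.Disjoint N) :
    row u D i N.reverse * row u B i M.reverse * block u C M.reverse N
      = block u C M.reverse N * row u B i M.reverse * row u D i N.reverse :=
  mul_prod_mul_prod (List.nodup_reverse.2 hM)
    (fun k hk => by
      have hk := List.mem_reverse.1 hk
      exact H.row_D_B_C (by grind) hi' (hMN hk) hN)
    fun j hj l hl hjl => Commute.row_right fun k hk => by
      have hj := List.mem_reverse.1 hj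
      have hl := List.mem_reverse.1 hl
      exact H.comm _ _ _ _ _ _ (by grind) (by grind) (by grind) (fun e => hMN hj (e ▸ hk))

theorem commute_t_row (H : IsExchange u t A B C D)
    {X : K} {i j : ι} {N : List ι} (hij : i ≠ j) (hi : i ∉ N) :
    Commute (t i) (row u X j N) :=
  Commute.row_right fun k hk => H.comm_t _ _ _ _ hij (by grind)

theorem commute_tilde (H : IsExchange u t A B C D)
    {X : K} {i j : ι} {N : List ι} (hi : i ∉ N) (hj : j ∉ N) :
    Commute (u X i j) (tilde u t A B N) :=
  Commute.tilde_right
    (fun Y k hk l hl => H.comm _ _ _ _ _ _ (by grind) (by grind) (by grind) (by grind))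
    fun k hk => (H.comm_t _ _ _ _ (by grind) (by grind)).symm

theorem commute_row_tilde (H : IsExchange u t A B C D)
    {X : K} {i : ι} {M N : List ι} (hi : i ∉ N) (hMN : ∀ j ∈ M, j ∉ N) :
    Commute (row u X i M) (tilde u t A B N) :=
  (Commute.row_right fun j hj => (H.commute_tilde hi (hMN j hj)).symm).symm

/-- The fused exchange relation for a single label `i` and an ordered label set `N`. -/
theorem exch_row (H : IsExchange u t A B C D) {i : ι} {N : List ι} (hi : i ∉ N) (hN : N.Nodup) :
    row u A i N * t i * row u B i N.reverse * tilde u t A B N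
      = tilde u t A B N * row u C i N * t i * row u D i N.reverse := by
  induction N with
  | nil => simp [row, tilde]
  | cons j N ih =>
    obtain ⟨hj, hN⟩ := List.nodup_cons.1 hN
    obtain ⟨hij, hi⟩ : i ≠ j ∧ i ∉ N := by simpa using hi
    have hir : i ∉ N.reverse := by simpa using hi
    have hjr : j ∉ N.reverse := by simpa using hj
    have ih := ih hi hN
    have e₁ := H.row_A_B_B hij hi hj hN
    have e₂ := H.row_A_A_A hij hi hj hN
    have e₃ := H.row_D_B_B hij hir hjr (List.nodup_reverse.2 hN)
    have e₄ := H.row_A_C_B hij hi hj hN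
    have c₁ : Commute (t i) (row u A j N) := H.commute_t_row hij hi
    have c₂ : Commute (t j) (row u B i N.reverse) := H.commute_t_row hij.symm hjr
    have c₃ : Commute (t j) (row u A i N) := H.commute_t_row hij.symm hj
    have c₄ : Commute (t i) (row u B j N.reverse) := H.commute_t_row hij hir
    have c₅ : Commute (u C i j) (tilde u t A B N) := H.commute_tilde hi hj
    have c₆ : Commute (u D i j) (tilde u t A B N) := H.commute_tilde hi hj
    have ex := H.exch i j hij
    simp only [tilde, row_cons, row_reverse_cons]
    generalize tilde u t A B N = Y at *
    generalize row u A i N = Ai at *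
    generalize row u A j N = Aj at *
    generalize row u B i N.reverse = Bi at *
    generalize row u B j N.reverse = Bj at *
    generalize row u C i N = Ci at *
    generalize row u D i N.reverse = Di at *
    generalize u A i j = a at *
    generalize u B i j = b at *
    generalize u C i j = c at *
    generalize u D i j = d at *
    calc a * Ai * t i * (Bi * b) * (Aj * t j * Bj * Y)
        = a * Ai * t i * (Bi * b * Aj) * t j * Bj * Y := by simp only [mul_assoc]
      _ = a * Ai * (t i * Aj) * b * Bi * t j * Bj * Y := by rw [← e₁]; simp only [mul_assoc]
      _ = (a * Ai * Aj) * t i * b * (Bi * t j) * Bj * Y := by rw [c₁.eq]; simp only [mul_assoc]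
      _ = Aj * Ai * (a * t i * b * t j) * Bi * Bj * Y := by
          rw [e₂, ← c₂.eq]; simp only [mul_assoc]
      _ = Aj * Ai * t j * c * t i * (d * Bi * Bj) * Y := by rw [ex]; simp only [mul_assoc]
      _ = Aj * (Ai * t j) * c * (t i * Bj) * Bi * d * Y := by rw [e₃]; simp only [mul_assoc]
      _ = Aj * t j * (Ai * c * Bj) * t i * Bi * (d * Y) := by
          rw [← c₃.eq, c₄.eq]; simp only [mul_assoc]
      _ = Aj * t j * Bj * c * (Ai * t i * Bi * Y) * d := by
          rw [e₄, c₆.eq]; simp only [mul_assoc]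
      _ = Aj * t j * Bj * (c * Y) * Ci * t i * Di * d := by rw [ih]; simp only [mul_assoc]
      _ = Aj * t j * Bj * Y * (c * Ci) * t i * (Di * d) := by rw [c₅.eq]; simp only [mul_assoc]

/-- The DKM-type fused exchange relation in a monoid. -/
theorem exch_block (H : IsExchange u t A B C D)
    {M N : List ι} (hM : M.Nodup) (hN : N.Nodup) (hMN : M.Disjoint N) :
    block u A M.reverse N * tilde u t A B M * block u B M N.reverse * tilde u t A B N
      = tilde u t A B N * block u C M.reverse N * tilde u t A B M * block u D M N.reverse := by
  induction M with
  | nil => simp [block, tilde]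
  | cons i M ih =>
    obtain ⟨hi, hM⟩ := List.nodup_cons.1 hM
    obtain ⟨hi', hMN⟩ := List.disjoint_cons_left.1 hMN
    have ih := ih hM hMN
    have hNM : ∀ j ∈ N.reverse, j ∉ M := fun j hj hj' => hMN hj' (List.mem_reverse.1 hj)
    have e₁ := H.block_A_A_A hi hi' hM hN hMN
    have e₂ := H.block_A_B_B hi hi' hM hN hMN
    have e₃ := H.block_D_B_C hi hi' hM hN hMN
    have e₄ := H.block_A_C_C hi hi' hM hN hMN
    have c₁ : Commute (t i) (block u A M.reverse N) := Commute.block_right fun j hj k hk =>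
      H.comm_t _ _ _ _ (fun e => hi (e ▸ List.mem_reverse.1 hj)) (fun e => hi' (e ▸ hk))
    have c₂ : Commute (t i) (block u C M.reverse N) := Commute.block_right fun j hj k hk =>
      H.comm_t _ _ _ _ (fun e => hi (e ▸ List.mem_reverse.1 hj)) (fun e => hi' (e ▸ hk))
    have c₃ : Commute (row u B i N.reverse) (tilde u t A B M) := H.commute_row_tilde hi hNM
    have c₄ : Commute (row u D i N.reverse) (tilde u t A B M) := H.commute_row_tilde hi hNM
    have c₅ : Commute (row u B i M.reverse) (tilde u t A B N) :=
      H.commute_row_tilde hi' fun j hj => hMN (List.mem_reverse.1 hj)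
    have c₆ : Commute (row u A i M) (tilde u t A B N) := H.commute_row_tilde hi' fun j hj => hMN hj
    have ex := H.exch_row hi' hN
    simp only [tilde, block_cons, block_reverse_cons]
    generalize tilde u t A B N = Y at *
    generalize tilde u t A B M = X at *
    generalize block u A M.reverse N = A' at *
    generalize block u B M N.reverse = B' at *
    generalize block u C M.reverse N = C' at *
    generalize block u D M N.reverse = D' at *
    generalize row u A i M = AM at *
    generalize row u A i N = AN at *
    generalize row u B i M.reverse = BM at *
    generalize row u B i N.reverse = BN at *
    generalize row u C i N = CN at *
    generalize row u D i N.reverse = DN at *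
    calc A' * AN * (AM * t i * BM * X) * (BN * B') * Y
        = (A' * AN * AM) * t i * BM * (X * BN) * B' * Y := by simp only [mul_assoc]
      _ = AM * AN * (A' * t i) * BM * BN * X * B' * Y := by
          rw [← e₁, ← c₃.eq]; simp only [mul_assoc]
      _ = AM * AN * t i * (A' * BM * BN) * X * B' * Y := by
          rw [← c₁.eq]; simp only [mul_assoc]
      _ = AM * AN * t i * BN * BM * (A' * X * B' * Y) := by rw [e₂]; simp only [mul_assoc]
      _ = AM * AN * t i * BN * (BM * Y) * C' * X * D' := by rw [ih]; simp only [mul_assoc]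
      _ = AM * (AN * t i * BN * Y) * BM * C' * X * D' := by rw [c₅.eq]; simp only [mul_assoc]
      _ = (AM * Y) * CN * t i * (DN * BM * C') * X * D' := by rw [ex]; simp only [mul_assoc]
      _ = Y * AM * CN * (t i * C') * BM * (DN * X) * D' := by
          rw [c₆.eq, e₃]; simp only [mul_assoc]
      _ = Y * (AM * CN * C') * t i * BM * X * DN * D' := by
          rw [c₂.eq, c₄.eq]; simp only [mul_assoc]
      _ = Y * (C' * CN) * (AM * t i * BM * X) * (DN * D') := by rw [e₄]; simp only [mul_assoc]

/-- `B_{iM̄} L_M = L_M B_{iM}`. -/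
theorem row_reverse_mul_lex (H : IsExchange u t A B C D)
    {i : ι} {M : List ι} (hi : i ∉ M) (hM : M.Nodup) :
    row u B i M.reverse * lex u A M = lex u A M * row u B i M := by
  induction M with
  | nil => simp [row, lex]
  | cons j M ih =>
    obtain ⟨hj, hM⟩ := List.nodup_cons.1 hM
    obtain ⟨hij, hi⟩ : i ≠ j ∧ i ∉ M := by simpa using hi
    have ih := ih hi hM
    have e := H.row_A_B_B hij hi hj hM
    have c : Commute (u B i j) (lex u A M) := Commute.lex_right fun k hk l hl =>
      H.comm _ _ _ _ _ _ (by grind) (by grind) (by grind) (by grind)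
    simp only [lex, row_cons, row_reverse_cons]
    calc row u B i M.reverse * u B i j * (row u A j M * lex u A M)
        = (row u B i M.reverse * u B i j * row u A j M) * lex u A M := by simp only [mul_assoc]
      _ = row u A j M * u B i j * (row u B i M.reverse * lex u A M) := by
          rw [← e]; simp only [mul_assoc]
      _ = row u A j M * (u B i j * lex u A M) * row u B i M := by
          rw [ih]; simp only [mul_assoc]
      _ = row u A j M * lex u A M * (u B i j * row u B i M) := by
          rw [c.eq]; simp only [mul_assoc]

theorem tilde_eq_lex_mul_straight (H : IsExchange u t A B C D) {M : List ι} (hM : M.Nodup) :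
    tilde u t A B M = lex u A M * straight u t B M := by
  induction M with
  | nil => simp [tilde, lex, straight]
  | cons i M ih =>
    obtain ⟨hi, hM⟩ := List.nodup_cons.1 hM
    have c : Commute (t i) (lex u A M) := Commute.lex_right fun k hk l hl =>
      H.comm_t _ _ _ _ (by grind) (by grind)
    simp only [tilde, lex, straight, ih hM]
    calc row u A i M * t i * row u B i M.reverse * (lex u A M * straight u t B M)
        = row u A i M * t i * (row u B i M.reverse * lex u A M) * straight u t B M := by
          simp only [mul_assoc]
      _ = row u A i M * (t i * lex u A M) * row u B i M * straight u t B M := by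
          rw [H.row_reverse_mul_lex hi hM]; simp only [mul_assoc]
      _ = row u A i M * lex u A M * (t i * row u B i M * straight u t B M) := by
          rw [c.eq]; simp only [mul_assoc]

end IsExchange

end Exchange

section Local

/-- `X` acts as the identity off the sites in `s`. -/
def ActsOn [Zero α] (s : Set ι) (X : Tens ι n α) : Prop :=
  (∀ f g : ι → Fin n, ∀ k ∉ s, f k ≠ g k → X f g = 0) ∧
  ∀ f g f' g' : ι → Fin n, (∀ k ∈ s, f k = f' k) → (∀ k ∈ s, g k = g' k) →
    (∀ k ∉ s, f k = g k) → (∀ k ∉ s, f' k = g' k) → X f g = X f' g'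

theorem actsOn_emb2 [MulZeroOneClass α] (X : M2 n α) (i j : ι) :
    ActsOn {i, j} (emb2 X i j) := by
  refine ⟨fun f g k hk hfg => ?_, fun f g f' g' hf hg hfg hfg' => ?_⟩
  · exact if_neg fun h => hfg (h k (by grind) (by grind))
  · simp only [emb2, Matrix.of_apply]
    rw [if_pos fun k hi hj => hfg k (by grind), if_pos fun k hi hj => hfg' k (by grind),
      hf i (by simp), hf j (by simp), hg i (by simp), hg j (by simp)]

theorem actsOn_emb1 [Zero α] (T : Matrix (Fin n) (Fin n) α) (i : ι) :
    ActsOn {i} (emb1 T i) := by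
  refine ⟨fun f g k hk hfg => ?_, fun f g f' g' hf hg hfg hfg' => ?_⟩
  · exact if_neg fun h => hfg (h k (by grind))
  · simp only [emb1, Matrix.of_apply]
    rw [if_pos fun k hi => hfg k (by grind), if_pos fun k hi => hfg' k (by grind),
      hf i (by simp), hg i (by simp)]

open Classical in
theorem ActsOn.mul_apply [Semiring α] {s s' : Set ι} {X Y : Tens ι n α} (hX : ActsOn s X)
    (hY : ActsOn s' Y) (hs : Disjoint s s') (f g : ι → Fin n) :
    (X * Y) f g = X f (fun k => if k ∈ s then g k else f k) *
      Y (fun k => if k ∈ s then g k else f k) g := by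
  rw [Matrix.mul_apply]
  refine Finset.sum_eq_single _ (fun h _ hh => ?_) (by simp)
  obtain ⟨k, hk⟩ := Function.ne_iff.1 hh
  by_cases hks : k ∈ s
  · rw [hY.1 h g k (Set.disjoint_left.1 hs hks) (by simpa [hks] using hk), mul_zero]
  · rw [hX.1 f h k hks (by simpa [hks] using hk.symm), zero_mul]

open Classical in
theorem ActsOn.commute [Semiring α] {s s' : Set ι} {X Y : Tens ι n α} (hX : ActsOn s X)
    (hY : ActsOn s' Y) (hs : Disjoint s s') (hXY : ∀ f g f' g', Commute (X f g) (Y f' g')) :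
    Commute X Y := by
  ext f g
  rw [hX.mul_apply hY hs, hY.mul_apply hX hs.symm]
  have hd := Set.disjoint_left.1 hs
  by_cases hfg : ∃ k, k ∉ s ∧ k ∉ s' ∧ f k ≠ g k
  · obtain ⟨k, hk, hk', hne⟩ := hfg
    rw [hY.1 _ g k hk' (by simpa [hk] using hne), hX.1 _ g k hk (by simpa [hk'] using hne),
      mul_zero, mul_zero]
  · push Not at hfg
    rw [(hXY _ _ _ _).eq]
    congr 1
    · exact hY.2 _ _ _ _ (by grind) (by grind) (by grind) (by grind)
    · exact hX.2 _ _ _ _ (by grind) (by grind) (by grind) (by grind)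

end Local

section Lift

variable {κ : Type*} [Fintype κ] [DecidableEq κ]

open Classical in
/-- The embedding of operators along a map of sites, acting as the identity off its range. -/
noncomputable def lift [Zero α] (φ : κ → ι) (X : Tens κ n α) : Tens ι n α :=
  Matrix.of fun f g => if ∀ k ∉ Set.range φ, f k = g k then X (f ∘ φ) (g ∘ φ) else 0

theorem lift_mul [Semiring α] {φ : κ → ι} (hφ : φ.Injective) (X Y : Tens κ n α) :
    lift φ (X * Y) = lift φ X * lift φ Y := by
  ext f g
  have key : (lift φ X * lift φ Y) f g
      = ∑ h : κ → Fin n, X (f ∘ φ) h * lift φ Y (Function.extend φ h f) g := by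
    rw [Matrix.mul_apply]
    symm
    refine Finset.sum_of_injOn (fun h => Function.extend φ h f) ?_ (by simp) ?_ ?_
    · intro h _ h' _ e
      have := congrArg (· ∘ φ) e
      simpa [Function.extend_comp hφ] using this
    · intro h _ hh
      have hne : ¬ ∀ k ∉ Set.range φ, f k = h k := fun hk => hh ⟨h ∘ φ, by simp, by
        funext k
        by_cases hkr : k ∈ Set.range φ
        · obtain ⟨p, rfl⟩ := hkr
          simp [hφ.extend_apply]
        · simpa [Function.extend_apply' _ _ _ hkr] using hk k hkr⟩
      simp only [lift, Matrix.of_apply, if_neg hne, zero_mul]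
    · intro h _
      have : ∀ k ∉ Set.range φ, f k = Function.extend φ h f k := fun k hk =>
        (Function.extend_apply' _ _ _ hk).symm
      simp only [lift, Matrix.of_apply, if_pos this, Function.extend_comp hφ]
  have hext : ∀ h : κ → Fin n, lift φ Y (Function.extend φ h f) g
      = if ∀ k ∉ Set.range φ, f k = g k then Y h (g ∘ φ) else 0 := fun h => by
    simp only [lift, Matrix.of_apply, Function.extend_comp hφ]
    congr 1
    refine propext (forall₂_congr fun k hk => ?_)
    rw [Function.extend_apply' _ _ _ hk]
  rw [key]
  simp only [hext]
  by_cases hfg : ∀ k ∉ Set.range φ, f k = g k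
  · simp only [lift, Matrix.of_apply, if_pos hfg, Matrix.mul_apply]
  · simp only [lift, Matrix.of_apply, if_neg hfg, mul_zero, Finset.sum_const_zero]

theorem lift_emb2 [MulZeroOneClass α] {φ : κ → ι} (hφ : φ.Injective) (X : M2 n α) (p q : κ) :
    lift φ (emb2 X p q) = emb2 X (φ p) (φ q) := by
  ext f g
  simp only [lift, emb2, Matrix.of_apply, Function.comp_apply, ← ite_and]
  congr 1
  refine propext ⟨fun ⟨h₁, h₂⟩ k hp hq => ?_, fun h => ⟨fun k hk => ?_, fun r hp hq => ?_⟩⟩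
  · by_cases hk : k ∈ Set.range φ
    · obtain ⟨r, rfl⟩ := hk
      exact h₂ r (by grind) (by grind)
    · exact h₁ k hk
  · exact h k (fun e => hk ⟨p, e.symm⟩) (fun e => hk ⟨q, e.symm⟩)
  · exact h _ (hφ.ne hp) (hφ.ne hq)

theorem lift_emb1 [Zero α] {φ : κ → ι} (hφ : φ.Injective) (T : Matrix (Fin n) (Fin n) α) (p : κ) :
    lift φ (emb1 T p) = emb1 T (φ p) := by
  ext f g
  simp only [lift, emb1, Matrix.of_apply, Function.comp_apply, ← ite_and]
  congr 1
  refine propext ⟨fun ⟨h₁, h₂⟩ k hp => ?_, fun h => ⟨fun k hk => ?_, fun r hp => ?_⟩⟩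
  · by_cases hk : k ∈ Set.range φ
    · obtain ⟨r, rfl⟩ := hk
      exact h₂ r (by grind)
    · exact h₁ k hk
  · exact h k (fun e => hk ⟨p, e.symm⟩)
  · exact h _ (hφ.ne hp)

theorem emb2_map (X : M2 n ℂ) (i j : ι) :
    (emb2 X i j).map (algebraMap ℂ R) = emb2 (X.map (algebraMap ℂ R)) i j := by
  ext f g
  simp only [emb2, Matrix.map_apply, Matrix.of_apply, apply_ite (algebraMap ℂ R), map_zero]

theorem emb2_perm2 [MulZeroOneClass α] (X : M2 n α) (i j : ι) :
    emb2 (perm2 X) i j = emb2 X j i := by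
  ext f g
  simp only [emb2, perm2, Matrix.of_apply]
  congr 1
  exact propext ⟨fun h k hj hi => h k hi hj, fun h k hi hj => h k hj hi⟩

/-- A three-site relation of Yang–Baxter type holds at any three distinct sites. -/
theorem emb2_yangBaxter {X Y Z : M2 n ℂ}
    (h : emb2 (ι := Fin 3) X 0 1 * emb2 Y 0 2 * emb2 Z 1 2
      = emb2 Z 1 2 * emb2 Y 0 2 * emb2 X 0 1)
    {i j k : ι} (hij : i ≠ j) (hik : i ≠ k) (hjk : j ≠ k) :
    emb2 X i j * emb2 Y i k * emb2 Z j k = emb2 Z j k * emb2 Y i k * emb2 X i j := by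
  have hφ : Function.Injective ![i, j, k] := by
    intro a b
    fin_cases a <;> fin_cases b <;> simp [hij, hik, hjk, hij.symm, hik.symm, hjk.symm]
  simpa [lift_mul hφ, lift_emb2 hφ] using congrArg (lift ![i, j, k]) h

/-- The quadratic exchange relation holds at any two distinct sites. -/
theorem emb_exchange [Semiring α] {A B C D : M2 n α} {T : Matrix (Fin n) (Fin n) α}
    (h : emb2 (ι := Fin 2) A 0 1 * emb1 T 0 * emb2 B 0 1 * emb1 T 1
      = emb1 T 1 * emb2 C 0 1 * emb1 T 0 * emb2 D 0 1)
    {i j : ι} (hij : i ≠ j) :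
    emb2 A i j * emb1 T i * emb2 B i j * emb1 T j
      = emb1 T j * emb2 C i j * emb1 T i * emb2 D i j := by
  have hφ : Function.Injective ![i, j] := by
    intro a b
    fin_cases a <;> fin_cases b <;> simp [hij, hij.symm]
  simpa [lift_mul hφ, lift_emb2 hφ, lift_emb1 hφ] using congrArg (lift ![i, j]) h

end Lift

section Scalars

/-- The operator `X_{ij}` with entries in `R`. -/
noncomputable def scal (R : Type*) [Ring R] [Algebra ℂ R] (X : M2 n ℂ) (i j : ι) : Tens ι n R :=
  (emb2 X i j).map (algebraMap ℂ R)

theorem map_yangBaxter {X Y Z : Tens ι n ℂ} (h : X * Y * Z = Z * Y * X) :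
    X.map (algebraMap ℂ R) * Y.map (algebraMap ℂ R) * Z.map (algebraMap ℂ R)
      = Z.map (algebraMap ℂ R) * Y.map (algebraMap ℂ R) * X.map (algebraMap ℂ R) := by
  simpa only [Matrix.map_mul] using congrArg (fun W => W.map (algebraMap ℂ R)) h

theorem map_prod (L : List (Tens ι n ℂ)) :
    L.prod.map (algebraMap ℂ R) = (L.map fun X => X.map (algebraMap ℂ R)).prod :=
  map_list_prod (algebraMap ℂ R).mapMatrix L

theorem map_prod_emb2 (X : M2 n ℂ) (i : ι) (N : List ι) :
    ((N.map fun j => emb2 X i j).prod).map (algebraMap ℂ R) = row (scal R) X i N := by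
  rw [map_prod, List.map_map]
  rfl

theorem map_fuse (X : M2 n ℂ) (M N : List ι) :
    (fuse X M N).map (algebraMap ℂ R) = block (scal R) X M N := by
  rw [fuse, map_prod, List.map_map, block]
  exact congrArg List.prod (List.map_congr_left fun i _ => map_prod_emb2 X i N)

theorem fuseT2_eq (A B : M2 n ℂ) (T : Matrix (Fin n) (Fin n) R) (M : List ι) :
    fuseT2 A B T M = tilde (scal R) (emb1 T) A B M := by
  induction M with
  | nil => rfl
  | cons i M ih => simp only [fuseT2, tilde, map_prod_emb2, ih]

theorem fuseT_eq (B : M2 n ℂ) (T : Matrix (Fin n) (Fin n) R) (M : List ι) :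
    fuseT B T M = straight (scal R) (emb1 T) B M := by
  induction M with
  | nil => rfl
  | cons i M ih => rw [fuseT, straight, ih]; rfl

theorem map_lexA (A : M2 n ℂ) (M : List ι) :
    (lexA A M).map (algebraMap ℂ R) = lex (scal R) A M := by
  induction M with
  | nil => exact Matrix.map_one _ (map_zero _) (map_one _)
  | cons i M ih => rw [lexA, lex, Matrix.map_mul, map_prod_emb2, ih]

end Scalars

/-- DKM-type fusion of the quadratic exchange relation, and its
relation to the KS-type fusion via the coupling matrix `L_M`. -/
theorem DKM_fused_exchange {n : ℕ} (hn : 1 ≤ n)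
    {R : Type*} [Ring R] [Algebra ℂ R]
    (A B C D : M2 n ℂ)
    (hYBA : emb2 (ι := Fin 3) A 0 1 * emb2 A 0 2 * emb2 A 1 2
          = emb2 A 1 2 * emb2 A 0 2 * emb2 A 0 1)
    (hYBAC : emb2 (ι := Fin 3) A 0 1 * emb2 C 0 2 * emb2 C 1 2
          = emb2 C 1 2 * emb2 C 0 2 * emb2 A 0 1)
    (hYBD : emb2 (ι := Fin 3) D 0 1 * emb2 D 0 2 * emb2 D 1 2
          = emb2 D 1 2 * emb2 D 0 2 * emb2 D 0 1)
    (hYBDB : emb2 (ι := Fin 3) D 0 1 * emb2 B 0 2 * emb2 B 1 2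
          = emb2 B 1 2 * emb2 B 0 2 * emb2 D 0 1)
    (hUA : A * perm2 A = 1) (hUD : D * perm2 D = 1) (hBC : B = perm2 C)
    (T : Matrix (Fin n) (Fin n) R)
    (hT : (emb2 (ι := Fin 2) A 0 1).map (algebraMap ℂ R) * emb1 T 0 *
            (emb2 B 0 1).map (algebraMap ℂ R) * emb1 T 1
        = emb1 T 1 * (emb2 C 0 1).map (algebraMap ℂ R) * emb1 T 0 *
            (emb2 D 0 1).map (algebraMap ℂ R))
    {ι : Type} [Fintype ι] [DecidableEq ι] :
    (∀ M N : List ι, OkPair M N →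
      (fuse A M.reverse N).map (algebraMap ℂ R) * fuseT2 A B T M *
        (fuse B M N.reverse).map (algebraMap ℂ R) * fuseT2 A B T N
      = fuseT2 A B T N * (fuse C M.reverse N).map (algebraMap ℂ R) * fuseT2 A B T M *
        (fuse D M N.reverse).map (algebraMap ℂ R)) ∧
    (∀ M : List ι, M.Nodup →
      fuseT2 A B T M = (lexA A M).map (algebraMap ℂ R) * fuseT B T M) := by
  have H : IsExchange (scal (ι := ι) R) (emb1 T) A B C D :=
    { comm := fun X Y i j k l hik hil hjk hjl => by
        rw [scal, scal, emb2_map, emb2_map]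
        refine (actsOn_emb2 _ i j).commute (actsOn_emb2 _ k l) ?_ fun f g f' g' => ?_
        · simp [Set.disjoint_left, hik, hil, hjk, hjl]
        · rw [← emb2_map]
          exact Algebra.commutes _ _
      comm_t := fun X i j k hij hik => by
        rw [scal, emb2_map]
        refine ((actsOn_emb2 _ j k).commute (actsOn_emb1 T i) ?_ fun f g f' g' => ?_).symm
        · simp [Set.disjoint_left, hij.symm, hik.symm]
        · rw [← emb2_map]
          exact Algebra.commutes _ _
      flip := fun i j => by rw [scal, scal, hBC, emb2_perm2]
      yb := fun i j k hij hik hjk => map_yangBaxter (emb2_yangBaxter hYBA hij hik hjk)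
      ybC := fun i j k hij hik hjk => map_yangBaxter (emb2_yangBaxter hYBAC hij hik hjk)
      ybB := fun i j k hij hik hjk => map_yangBaxter (emb2_yangBaxter hYBDB hij hik hjk)
      exch := fun i j hij => by
        simp only [emb2_map] at hT
        simpa only [scal, emb2_map] using emb_exchange hT hij }
  refine ⟨fun M N h => ?_, fun M hM => ?_⟩
  · simp only [map_fuse, fuseT2_eq]
    exact H.exch_block h.1 h.2.1 h.2.2
  · rw [fuseT2_eq, fuseT_eq, map_lexA]
    exact H.tilde_eq_lex_mul_straight hM

end QT
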